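/- arXiv:2003.06147 — 2 statements merged into one kernel-verified Lean document; each statement's English description precedes it below -/
import Mathlib

section
/- Let 1 ≤ m ≤ n be integers and let λ = (λ_1,…,λ_n) ∈ Γ_m with λ_1 ≥ λ_2 ≥ ⋯ ≥ λ_n. Then λ_1 ≥ λ_2 ≥ ⋯ ≥ λ_m > 0, and σ_m(λ) ≤ C_n^m·λ_1·λ_2⋯λ_m, where C_n^m = n!/(m!(n−m)!). -/
/-- The `m`-th elementary symmetric function of `λ = (λ_1, …, λ_n) ∈ ℝⁿ`. -/
def esymm (n m : ℕ) (lam : Fin n → ℝ) : ℝ :=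
  ∑ s ∈ (Finset.univ : Finset (Fin n)).powersetCard m, ∏ i ∈ s, lam i

/-- The Gårding cone `Γ_m = {λ ∈ ℝⁿ : σ_j(λ) > 0 for all 1 ≤ j ≤ m}`. -/
def GardingCone (n m : ℕ) : Set (Fin n → ℝ) :=
  {lam | ∀ j : ℕ, 1 ≤ j → j ≤ m → 0 < esymm n j lam}

open Polynomial in
theorem Polynomial.Splits.derivative_of_real {p : ℝ[X]} (hp : p.Splits) : p.derivative.Splits := by
  rcases Nat.eq_zero_or_pos p.natDegree with h | h
  · rw [natDegree_eq_zero] at h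
    obtain ⟨c, rfl⟩ := h
    simp
  · rw [splits_iff_card_roots] at hp ⊢
    have h₁ := card_roots_le_derivative p
    have h₂ := natDegree_derivative_lt h.ne'
    have h₃ := p.derivative.card_roots'
    omega

open Polynomial in
theorem Polynomial.Splits.iterate_derivative_of_real {p : ℝ[X]} (hp : p.Splits) (k : ℕ) :
    (derivative^[k] p).Splits := by
  induction k with
  | zero => exact hp
  | succ k ih =>
    rw [Function.iterate_succ_apply']
    exact ih.derivative_of_real

open Polynomial in
theorem Polynomial.Splits.two_mul_coeff_zero_mul_coeff_two_le {p : ℝ[X]} (hp : p.Splits) :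
    2 * (p.coeff 0 * p.coeff 2) ≤ p.coeff 1 ^ 2 := by
  have key (s : Multiset ℝ) : 2 * ((s.map (X - C ·)).prod.coeff 0 *
      (s.map (X - C ·)).prod.coeff 2) ≤ (s.map (X - C ·)).prod.coeff 1 ^ 2 := by
    induction s using Multiset.induction with
    | empty => simp [coeff_one]
    | cons a s ih =>
      simp only [Multiset.map_cons, Multiset.prod_cons]
      generalize (s.map (X - C ·)).prod = q at ih ⊢
      simp only [sub_mul, coeff_sub, coeff_C_mul, coeff_X_mul_zero,
        coeff_X_mul q 0, coeff_X_mul q 1]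
      nlinarith [sq_nonneg (q.coeff 0), mul_le_mul_of_nonneg_left ih (sq_nonneg a)]
  rw [hp.eq_prod_roots]
  simp only [coeff_C_mul]
  nlinarith [mul_le_mul_of_nonneg_left (key p.roots) (sq_nonneg p.leadingCoeff)]

open Polynomial in
/-- Log-concavity of the coefficients of a real-rooted polynomial (a weak form of Newton's
inequalities). -/
theorem Polynomial.Splits.coeff_mul_coeff_le {p : ℝ[X]} (hp : p.Splits) (k : ℕ) :
    p.coeff k * p.coeff (k + 2) ≤ p.coeff (k + 1) ^ 2 := by
  have h := (hp.iterate_derivative_of_real k).two_mul_coeff_zero_mul_coeff_two_le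
  have h₁ : (k + 1).descFactorial k = (k + 1) * k.factorial := by
    rw [Nat.descFactorial_eq_factorial_mul_choose, Nat.choose_succ_self_right, mul_comm]
  have h₂ : 2 * (k + 2).descFactorial k = (k + 2) * (k + 1) * k.factorial := by
    have := Nat.factorial_mul_descFactorial (show k ≤ k + 2 by omega)
    simp only [Nat.add_sub_cancel_left, Nat.factorial] at this
    linarith
  simp only [coeff_iterate_derivative, nsmul_eq_mul, zero_add, Nat.descFactorial_self,
    add_comm 1 k, add_comm 2 k, h₁] at h
  have h₂' : (2 : ℝ) * ((k + 2).descFactorial k : ℝ) = (k + 2) * (k + 1) * k.factorial := by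
    exact_mod_cast h₂
  have hf : (0 : ℝ) < k.factorial := by positivity
  have h₃ : ((k : ℝ) + 2) * (p.coeff k * p.coeff (k + 2)) ≤ (k + 1) * p.coeff (k + 1) ^ 2 := by
    refine le_of_mul_le_mul_left ?_ (show (0 : ℝ) < (k + 1) * k.factorial ^ 2 by positivity)
    push_cast at h
    linear_combination h - k.factorial * p.coeff k * p.coeff (k + 2) * h₂'
  by_contra! hlt
  nlinarith [sq_nonneg (p.coeff (k + 1)), (Nat.cast_nonneg k : (0 : ℝ) ≤ k)]

theorem esymm_zero_right (n : ℕ) (lam : Fin n → ℝ) : esymm n 0 lam = 1 := by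
  simp [esymm]

theorem esymm_eq_zero_of_lt {n m : ℕ} (h : n < m) (lam : Fin n → ℝ) : esymm n m lam = 0 := by
  rw [esymm, Finset.powersetCard_eq_empty.2 (by simpa using h), Finset.sum_empty]

theorem esymm_succ_succ (n m : ℕ) (lam : Fin (n + 1) → ℝ) :
    esymm (n + 1) (m + 1) lam =
      esymm n (m + 1) (Fin.tail lam) + lam 0 * esymm n m (Fin.tail lam) := by
  simp only [esymm, ← Finset.esymm_map_val, Fin.univ_succ, Finset.cons_val, Finset.map_val,
    Multiset.map_cons, Multiset.map_map, Multiset.esymm, Multiset.powersetCard_cons,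
    Multiset.map_add, Multiset.sum_add, Function.comp_def, Multiset.prod_cons,
    Multiset.sum_map_mul_left]
  rfl

open Polynomial in
theorem esymm_mul_esymm_le (n k : ℕ) (lam : Fin n → ℝ) :
    esymm n k lam * esymm n (k + 2) lam ≤ esymm n (k + 1) lam ^ 2 := by
  rcases lt_or_ge n (k + 2) with h | h
  · rw [esymm_eq_zero_of_lt h, mul_zero]
    positivity
  · have hc (j : ℕ) (hj : j ≤ n) :
        (∏ i, (X + C (lam i))).coeff j = esymm n (n - j) lam := by
      simpa [esymm] using Finset.prod_X_add_C_coeff Finset.univ lam (k := j) (by simpa using hj)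
    have := (Splits.prod (s := Finset.univ) fun i _ ↦ Splits.X_add_C (lam i)).coeff_mul_coeff_le
      (n - k - 2)
    rw [hc _ (by omega), hc _ (by omega), hc _ (by omega)] at this
    rw [show n - (n - k - 2) = k + 2 by omega, show n - (n - k - 2 + 2) = k by omega,
      show n - (n - k - 2 + 1) = k + 1 by omega] at this
    linarith

theorem tail_mem_gardingCone {n m : ℕ} {lam : Fin (n + 1) → ℝ}
    (h : lam ∈ GardingCone (n + 1) (m + 1)) : Fin.tail lam ∈ GardingCone n m := by
  suffices H : ∀ j ≤ m, 0 < esymm n j (Fin.tail lam) from fun j _ hj ↦ H j hj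
  intro j
  induction j with
  | zero => simp [esymm_zero_right]
  | succ j ih =>
    intro hj
    have h₀ := ih (by omega)
    have h₁ := h (j + 1) (by omega) (by omega)
    have h₂ := h (j + 2) (by omega) (by omega)
    have h₃ := esymm_mul_esymm_le n j (Fin.tail lam)
    rw [esymm_succ_succ] at h₁ h₂
    by_contra! hneg
    nlinarith [mul_lt_mul_of_pos_left h₂ h₀, mul_le_mul_of_nonneg_left h₁.le (neg_nonneg.2 hneg)]

theorem GardingCone.head_pos {n m : ℕ} {lam : Fin (n + 1) → ℝ} (hm : 1 ≤ m)
    (h : lam ∈ GardingCone (n + 1) m) (hlam : Antitone lam) : 0 < lam 0 := by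
  have h₁ := h 1 le_rfl hm
  simp only [esymm, Finset.powersetCard_one, Finset.sum_map, Function.Embedding.coeFn_mk,
    Finset.prod_singleton] at h₁
  by_contra! h₀
  exact h₁.not_ge (Finset.sum_nonpos fun i _ ↦ (hlam (Fin.zero_le i)).trans h₀)

theorem GardingCone.pos_of_lt {n m : ℕ} {lam : Fin n → ℝ} (h : lam ∈ GardingCone n m)
    (hlam : Antitone lam) (i : Fin n) (hi : (i : ℕ) < m) : 0 < lam i := by
  induction n generalizing m with
  | zero => exact i.elim0
  | succ n ih =>
    obtain ⟨m, rfl⟩ : ∃ k, m = k + 1 := ⟨m - 1, by omega⟩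
    cases i using Fin.cases with
    | zero => exact GardingCone.head_pos (by omega) h hlam
    | succ i =>
      exact ih (tail_mem_gardingCone h) (fun a b hab ↦ hlam (Fin.succ_le_succ_iff.2 hab)) i
        (by simpa using hi)

theorem GardingCone.esymm_le {n m : ℕ} (hmn : m ≤ n) {lam : Fin n → ℝ}
    (h : lam ∈ GardingCone n m) (hlam : Antitone lam) :
    esymm n m lam ≤ (n.choose m : ℝ) * ∏ i : Fin m, lam (Fin.castLE hmn i) := by
  induction n generalizing m with
  | zero =>
    obtain rfl : m = 0 := by omega
    simp [esymm_zero_right]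
  | succ n ih =>
    cases m with
    | zero => simp [esymm_zero_right]
    | succ m =>
      have htail : Antitone (Fin.tail lam) := fun a b hab ↦ hlam (Fin.succ_le_succ_iff.2 hab)
      have h₀ : 0 < lam 0 := GardingCone.head_pos (by omega) h hlam
      have hmem := tail_mem_gardingCone h
      have h₁ := ih (by omega) hmem htail
      have hprod : ∏ i : Fin (m + 1), lam (Fin.castLE hmn i) =
          lam 0 * ∏ i : Fin m, Fin.tail lam (Fin.castLE (by omega) i) := by
        rw [Fin.prod_univ_succ]
        rfl
      have hpos : 0 < ∏ i : Fin m, Fin.tail lam (Fin.castLE (by omega) i) :=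
        Finset.prod_pos fun i _ ↦ GardingCone.pos_of_lt hmem htail _ i.2
      have h₂ : esymm n (m + 1) (Fin.tail lam) ≤ (n.choose (m + 1) : ℝ) *
          (lam 0 * ∏ i : Fin m, Fin.tail lam (Fin.castLE (by omega) i)) := by
        rcases le_or_gt (esymm n (m + 1) (Fin.tail lam)) 0 with hneg | hσ
        · exact hneg.trans (by positivity)
        · have hle : m + 1 ≤ n := by
            by_contra! hlt
            exact hσ.ne' (esymm_eq_zero_of_lt hlt _)
          have hmem' : Fin.tail lam ∈ GardingCone n (m + 1) := by
            intro j hj hjm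
            rcases hjm.lt_or_eq with hjm | rfl
            · exact hmem j hj (by omega)
            · exact hσ
          refine (ih hle hmem' htail).trans ?_
          gcongr
          rw [Fin.prod_univ_castSucc, mul_comm]
          exact mul_le_mul_of_nonneg_right (hlam (Fin.zero_le _)) hpos.le
      rw [esymm_succ_succ, hprod, Nat.choose_succ_succ, Nat.cast_add]
      nlinarith [mul_le_mul_of_nonneg_left h₁ h₀.le]

/-- For `λ ∈ Γ_m` with `λ_1 ≥ λ_2 ≥ ⋯ ≥ λ_n`, one has `λ_1 ≥ ⋯ ≥ λ_m > 0` and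
`σ_m(λ) ≤ C_n^m · λ_1 ⋯ λ_m`, where `C_n^m` is the binomial coefficient. -/
theorem first_entries_pos_and_esymm_le (n m : ℕ) (hm : 1 ≤ m) (hmn : m ≤ n)
    (lam : Fin n → ℝ) (hlam : lam ∈ GardingCone n m)
    (hsorted : ∀ i j : Fin n, i ≤ j → lam j ≤ lam i) :
    (∀ i : Fin n, (i : ℕ) < m → 0 < lam i) ∧
      esymm n m lam ≤ (n.choose m : ℝ) * ∏ i : Fin m, lam (Fin.castLE hmn i) :=
  have hmono : Antitone lam := fun i j hij ↦ hsorted i j hij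
  ⟨GardingCone.pos_of_lt hlam hmono, GardingCone.esymm_le hmn hlam hmono⟩
end

section
/- Let 2 ≤ k ≤ n be integers, let α_0, α_1, …, α_{k−1} be positive real numbers, and let λ ∈ Γ_k satisfy σ_k(λ) = Σ_{l=0}^{k−1} α_l·σ_l(λ). Then α_{k−1} ≤ σ_k(λ)/σ_{k−1}(λ) ≤ max( 1 , Σ_{l=0}^{k−1} α_l·(C_n^k)^{k−1−l}·C_n^l/(C_n^{k−1})^{k−l} ). -/
open Polynomial in
theorem Polynomial.laguerre_multiset (m : Multiset ℝ) (x : ℝ) :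
    (m.card : ℝ) * (((m.map (X - C ·)).prod.eval x) *
        (derivative (derivative (m.map (X - C ·)).prod)).eval x) ≤
      ((m.card : ℝ) - 1) * ((derivative (m.map (X - C ·)).prod).eval x) ^ 2 := by
  induction m using Multiset.induction with
  | empty => simp
  | cons a s ih =>
    simp only [Multiset.map_cons, Multiset.prod_cons, Multiset.card_cons, Nat.cast_add,
      Nat.cast_one, derivative_mul, derivative_add, derivative_sub, derivative_X, derivative_C,
      eval_add, eval_mul, eval_sub, eval_X, eval_C, sub_zero, one_mul,
      add_sub_cancel_right]
    rcases Nat.eq_zero_or_pos s.card with hs | hs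
    · obtain rfl := Multiset.card_eq_zero.mp hs
      simp
    have hd : (0 : ℝ) < s.card := by exact_mod_cast hs
    generalize (s.card : ℝ) = d at ih hd ⊢
    generalize eval x (s.map (X - C ·)).prod = R at ih ⊢
    generalize eval x (derivative (s.map (X - C ·)).prod) = R' at ih ⊢
    generalize eval x (derivative (derivative (s.map (X - C ·)).prod)) = R'' at ih ⊢
    generalize x - a = t
    refine le_of_mul_le_mul_left ?_ hd
    have key := mul_le_mul_of_nonneg_left ih (mul_nonneg (sq_nonneg t) (by linarith : 0 ≤ d + 1))
    nlinarith [sq_nonneg (d * R - t * R')]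

open Polynomial in
/-- **Laguerre's inequality** for real-rooted polynomials. -/
theorem Polynomial.Splits.laguerre {p : ℝ[X]} (hp : p.Splits) (x : ℝ) :
    (p.natDegree : ℝ) * (p.eval x * (derivative (derivative p)).eval x) ≤
      ((p.natDegree : ℝ) - 1) * ((derivative p).eval x) ^ 2 := by
  have h := laguerre_multiset p.roots x
  rw [← hp.natDegree_eq_card_roots] at h
  have hx := mul_le_mul_of_nonneg_left h (sq_nonneg p.leadingCoeff)
  have h₀ : p.eval x = p.leadingCoeff * (p.roots.map (X - C ·)).prod.eval x := by
    conv_lhs => rw [hp.eq_prod_roots]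
    simp only [eval_mul, eval_C]
  have h₁ : (derivative p).eval x =
      p.leadingCoeff * (derivative (p.roots.map (X - C ·)).prod).eval x := by
    conv_lhs => rw [hp.eq_prod_roots]
    simp only [derivative_C_mul, eval_mul, eval_C]
  have h₂ : (derivative (derivative p)).eval x =
      p.leadingCoeff * (derivative (derivative (p.roots.map (X - C ·)).prod)).eval x := by
    conv_lhs => rw [hp.eq_prod_roots]
    simp only [derivative_C_mul, eval_mul, eval_C]
  rw [h₀, h₁, h₂]
  linarith

open Polynomial in
theorem Polynomial.natDegree_derivative_real (p : ℝ[X]) :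
    (derivative p).natDegree = p.natDegree - 1 := by
  rcases Nat.eq_zero_or_pos p.natDegree with h | h
  · rw [derivative_of_natDegree_zero h, h, natDegree_zero]
  · exact natDegree_eq_of_degree_eq_some (degree_derivative h.ne')

open Polynomial in
/-- The derivative of a real-rooted polynomial is real-rooted. -/
theorem Polynomial.Splits.derivative_real {p : ℝ[X]} (hp : p.Splits) :
    (derivative p).Splits := by
  rw [splits_iff_card_roots]
  refine le_antisymm (card_roots' _) ?_
  have h := card_roots_le_derivative p
  rw [← hp.natDegree_eq_card_roots] at h
  rw [natDegree_derivative_real]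
  omega

open Polynomial in
theorem Polynomial.Splits.iterate_derivative_real {p : ℝ[X]} (hp : p.Splits) (m : ℕ) :
    (derivative^[m] p).Splits ∧ (derivative^[m] p).natDegree = p.natDegree - m := by
  induction m with
  | zero => exact ⟨hp, rfl⟩
  | succ m ih =>
    rw [Function.iterate_succ_apply']
    exact ⟨ih.1.derivative_real, by rw [natDegree_derivative_real, ih.2, Nat.sub_sub]⟩

open Polynomial in
/-- **Newton's inequality** for the coefficients of a real-rooted polynomial. -/
theorem Polynomial.Splits.newton {p : ℝ[X]} (hp : p.Splits) {m j : ℕ}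
    (hm : p.natDegree = m + j + 1) :
    ((j : ℝ) + 1) * (m + 2) * (p.coeff m * p.coeff (m + 2)) ≤
      j * (m + 1) * p.coeff (m + 1) ^ 2 := by
  obtain ⟨hs, hd⟩ := hp.iterate_derivative_real m
  have h := hs.laguerre 0
  rw [hd, hm, show m + j + 1 - m = j + 1 by omega, ← Function.iterate_succ_apply' derivative,
    ← Function.iterate_succ_apply' derivative] at h
  simp only [← coeff_zero_eq_eval_zero, coeff_iterate_derivative, zero_add,
    Nat.descFactorial_self, nsmul_eq_mul, Nat.succ_eq_add_one, Nat.factorial_succ] at h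
  push_cast at h
  have hf : (0 : ℝ) < (m.factorial : ℝ) ^ 2 * (m + 1) := by positivity
  refine le_of_mul_le_mul_left ?_ hf
  linarith

open Polynomial in
/-- **Newton's inequality** for elementary symmetric functions. -/
theorem esymm_newton (n j : ℕ) (hj : 1 ≤ j) (hjn : j < n) (lam : Fin n → ℝ) :
    ((j : ℝ) + 1) * (n - j + 1) * (esymm n (j + 1) lam * esymm n (j - 1) lam) ≤
      j * (n - j) * esymm n j lam ^ 2 := by
  have hcoeff (i : ℕ) (hi : i ≤ n) :
      (∏ a : Fin n, (X + C (lam a))).coeff i = esymm n (n - i) lam := by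
    rw [Finset.prod_X_add_C_coeff _ _ (by simpa using hi), Finset.card_fin]
    rfl
  have hs : (∏ a : Fin n, (X + C (lam a))).Splits := Splits.prod fun a _ ↦ Splits.X_add_C _
  have hdeg : (∏ a : Fin n, (X + C (lam a))).natDegree = n := by
    rw [natDegree_prod_of_monic _ _ fun a _ ↦ monic_X_add_C _]
    simp
  obtain ⟨m, rfl⟩ : ∃ m, n = m + j + 1 := ⟨n - j - 1, by omega⟩
  have h := hs.newton hdeg
  rw [hcoeff _ (by omega), hcoeff _ (by omega), hcoeff _ (by omega),
    show m + j + 1 - m = j + 1 by omega, show m + j + 1 - (m + 2) = j - 1 by omega,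
    show m + j + 1 - (m + 1) = j by omega] at h
  push_cast
  ring_nf at h ⊢
  linarith

/-- The normalized elementary symmetric functions are log-concave. -/
theorem esymm_div_choose_log_concave (n j : ℕ) (hjn : j + 2 ≤ n) (lam : Fin n → ℝ) :
    esymm n (j + 2) lam / n.choose (j + 2) * (esymm n j lam / n.choose j) ≤
      (esymm n (j + 1) lam / n.choose (j + 1)) ^ 2 := by
  have h := esymm_newton n (j + 1) (by omega) (by omega) lam
  simp only [Nat.add_sub_cancel, add_assoc, Nat.reduceAdd] at h
  have c₀ : (0 : ℝ) < n.choose j := by exact_mod_cast Nat.choose_pos (by omega)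
  have c₁ : (0 : ℝ) < n.choose (j + 1) := by exact_mod_cast Nat.choose_pos (by omega)
  have c₂ : (0 : ℝ) < n.choose (j + 2) := by exact_mod_cast Nat.choose_pos (by omega)
  have e₁ : (n.choose (j + 1) : ℝ) * (j + 1) = n.choose j * (n - j) := by
    have := Nat.choose_succ_right_eq n j
    rw [← Nat.cast_sub (by omega)]
    exact_mod_cast this
  have e₂ : (n.choose (j + 2) : ℝ) * (j + 2) = n.choose (j + 1) * (n - j - 1) := by
    have := Nat.choose_succ_right_eq n (j + 1)
    rw [sub_sub, ← Nat.cast_add_one, ← Nat.cast_sub (by omega)]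
    exact_mod_cast this
  have hn : (j : ℝ) + 2 ≤ n := by exact_mod_cast hjn
  push_cast at h
  generalize esymm n j lam = s₀ at *
  generalize esymm n (j + 1) lam = s₁ at *
  generalize esymm n (j + 2) lam = s₂ at *
  generalize (n.choose j : ℝ) = a at *
  generalize (n.choose (j + 1) : ℝ) = b at *
  generalize (n.choose (j + 2) : ℝ) = c at *
  have ha : a = b * (j + 1) / (n - j) := by
    rw [eq_div_iff (by linarith)]
    exact e₁.symm
  have hc : c = b * (n - j - 1) / (j + 2) := by
    rw [eq_div_iff (by positivity)]
    exact e₂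
  rw [div_mul_div_comm, div_pow, div_le_div_iff₀ (by positivity) (by positivity), ha, hc]
  have p₁ : (0 : ℝ) < n - j := by linarith
  have p₂ : (0 : ℝ) < (j : ℝ) + 2 := by positivity
  rw [show s₁ ^ 2 * (b * (n - j - 1) / (j + 2) * (b * (j + 1) / (n - j))) =
    s₁ ^ 2 * b ^ 2 * (n - j - 1) * (j + 1) / ((j + 2) * (n - j)) by field_simp,
    le_div_iff₀ (by positivity)]
  have := mul_le_mul_of_nonneg_left h (sq_nonneg b)
  linarith

/-- For a positive log-concave sequence the ratio of consecutive terms is nonincreasing. -/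
theorem log_concave_ratio_le {p : ℕ → ℝ} {k : ℕ} (hpos : ∀ j ≤ k + 1, 0 < p j)
    (hlc : ∀ j < k, p (j + 2) * p j ≤ p (j + 1) ^ 2) {j : ℕ} (hj : j ≤ k) :
    p (k + 1) * p j ≤ p k * p (j + 1) := by
  induction hj using Nat.decreasingInduction with
  | self => exact (mul_comm _ _).le
  | of_succ j hj ih =>
    have h₁ := hpos (j + 1) (by omega)
    have h₂ := hpos (j + 2) (by omega)
    refine le_of_mul_le_mul_right ?_ (mul_pos h₁ h₂)
    have := mul_le_mul ih (hlc j hj) (mul_pos h₂ (hpos j (by omega))).le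
      (mul_pos (hpos k (by omega)) h₂).le
    linarith

theorem log_concave_pow_le {p : ℕ → ℝ} {k : ℕ} (hpos : ∀ j ≤ k + 1, 0 < p j)
    (hlc : ∀ j < k, p (j + 2) * p j ≤ p (j + 1) ^ 2) (l i : ℕ) (hli : l + i ≤ k) :
    p l * p (k + 1) ^ i ≤ p k ^ i * p (l + i) := by
  induction i with
  | zero => simp
  | succ i ih =>
    calc p l * p (k + 1) ^ (i + 1) = p l * p (k + 1) ^ i * p (k + 1) := by ring
      _ ≤ p k ^ i * p (l + i) * p (k + 1) :=
        mul_le_mul_of_nonneg_right (ih (by omega)) (hpos _ le_rfl).le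
      _ = p k ^ i * (p (k + 1) * p (l + i)) := by ring
      _ ≤ p k ^ i * (p k * p (l + i + 1)) :=
        mul_le_mul_of_nonneg_left (log_concave_ratio_le hpos hlc (by omega))
          (pow_pos (hpos k (by omega)) i).le
      _ = p k ^ (i + 1) * p (l + (i + 1)) := by ring_nf

/-- If `σ_{k+1} ≥ σ_k` in the Gårding cone, then `σ_l / σ_k` is bounded by binomial data. -/
theorem esymm_le_of_le_esymm_succ (n k l : ℕ) (hkn : k + 1 ≤ n) (hl : l ≤ k) (lam : Fin n → ℝ)
    (hpos : ∀ j ≤ k + 1, 0 < esymm n j lam) (h : esymm n k lam ≤ esymm n (k + 1) lam) :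
    esymm n l lam ≤ (n.choose (k + 1) : ℝ) ^ (k - l) * n.choose l /
      (n.choose k : ℝ) ^ (k + 1 - l) * esymm n k lam := by
  have hc (j : ℕ) (hj : j ≤ k + 1) : (0 : ℝ) < n.choose j := by
    exact_mod_cast Nat.choose_pos (by omega)
  have key := log_concave_pow_le (p := fun j ↦ esymm n j lam / n.choose j) (k := k)
    (fun j hj ↦ div_pos (hpos j hj) (hc j hj))
    (fun j hj ↦ esymm_div_choose_log_concave n j (by omega) lam) l (k - l) (by omega)
  obtain ⟨i, rfl⟩ : ∃ i, k = l + i := ⟨k - l, by omega⟩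
  simp only [Nat.add_sub_cancel_left, show l + i + 1 - l = i + 1 by omega] at key ⊢
  have s₁ := hpos (l + i) (by omega)
  have s₂ := hpos (l + i + 1) le_rfl
  have c₀ := hc l (by omega)
  have c₁ := hc (l + i) (by omega)
  have c₂ := hc (l + i + 1) le_rfl
  have hs := hpos l (by omega)
  generalize esymm n l lam = s at *
  generalize esymm n (l + i) lam = t at *
  generalize esymm n (l + i + 1) lam = u at *
  generalize (n.choose l : ℝ) = a at *
  generalize (n.choose (l + i) : ℝ) = b at *
  generalize (n.choose (l + i + 1) : ℝ) = c at *
  have hle : s / a * (t / c) ^ i ≤ (t / b) ^ i * (t / b) :=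
    le_trans (by gcongr) key
  rw [div_pow, div_pow, div_mul_div_comm, div_mul_div_comm, ← pow_succ, ← pow_succ,
    div_le_div_iff₀ (by positivity) (by positivity)] at hle
  rw [div_mul_eq_mul_div, le_div_iff₀ (by positivity)]
  refine le_of_mul_le_mul_right ?_ (pow_pos s₁ i)
  calc s * b ^ (i + 1) * t ^ i = s * t ^ i * b ^ (i + 1) := by ring
    _ ≤ t ^ (i + 1) * (a * c ^ i) := hle
    _ = c ^ i * a * t * t ^ i := by ring

/-- For `2 ≤ k ≤ n`, positive `α_0, …, α_{k-1}`, and `λ ∈ Γ_k` with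
`σ_k(λ) = Σ_{l=0}^{k-1} α_l·σ_l(λ)`, one has
`α_{k-1} ≤ σ_k(λ)/σ_{k-1}(λ) ≤ max(1, Σ_{l=0}^{k-1} α_l·(C_n^k)^{k-1-l}·C_n^l/(C_n^{k-1})^{k-l})`. -/
theorem quotient_bounds (n k : ℕ) (hk : 2 ≤ k) (hkn : k ≤ n) (α : ℕ → ℝ)
    (hα : ∀ l, l < k → 0 < α l) (lam : Fin n → ℝ) (hlam : lam ∈ GardingCone n k)
    (heq : esymm n k lam = ∑ l ∈ Finset.range k, α l * esymm n l lam) :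
    α (k - 1) ≤ esymm n k lam / esymm n (k - 1) lam ∧
      esymm n k lam / esymm n (k - 1) lam ≤
        max 1
          (∑ l ∈ Finset.range k,
            α l * ((n.choose k : ℝ) ^ (k - 1 - l) * (n.choose l : ℝ) /
              (n.choose (k - 1) : ℝ) ^ (k - l))) := by
  obtain ⟨k, rfl⟩ : ∃ m, k = m + 1 := ⟨k - 1, by omega⟩
  have hpos (j : ℕ) (hj : j ≤ k + 1) : 0 < esymm n j lam := by
    rcases Nat.eq_zero_or_pos j with rfl | h
    · simp [esymm]
    · exact hlam j h hj
  simp only [Nat.add_sub_cancel]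
  have hk₀ := hpos k (by omega)
  constructor
  · rw [le_div_iff₀ hk₀, heq]
    exact Finset.single_le_sum (f := fun l ↦ α l * esymm n l lam)
      (fun l hl ↦ mul_nonneg (hα l (Finset.mem_range.mp hl)).le
        (hpos l (Finset.mem_range.mp hl).le).le) (Finset.self_mem_range_succ k)
  · rcases le_total (esymm n (k + 1) lam) (esymm n k lam) with h | h
    · exact le_max_of_le_left ((div_le_one hk₀).mpr h)
    · refine le_max_of_le_right ?_
      rw [div_le_iff₀ hk₀, heq, Finset.sum_mul]
      refine Finset.sum_le_sum fun l hl ↦ ?_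
      rw [mul_assoc]
      exact mul_le_mul_of_nonneg_left
        (esymm_le_of_le_esymm_succ n k l hkn (Nat.le_of_lt_succ (Finset.mem_range.mp hl)) lam
          hpos h) (hα l (Finset.mem_range.mp hl)).le
end
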